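/- Let G be a Garside group and let x ∈ SSS(x) ⊆ G with inf(x) = p and ℓ(x) = r > 1. Suppose x is conjugate to a left rigid element, let N be such that y = c_L^N(x) is left rigid, and let C_i = ι_L(c_L^{i−1}(x)). Then: (1) there exists an integer M such that C₁⋯C_N is a right divisor (suffix) of (y^M)°_R; (2) for any such M, if z₁⋯z_N is the left normal form of C₁⋯C_N and z'₁⋯z'_s is the left normal form of (y^M)°_R·(C₁⋯C_N)⁻¹, then for every m ≥ M the left normal form of (x^m)°_L is (z₁⋯z_N)·(y^{m−M})°_L·(τ^{−pm}(z'₁)⋯τ^{−pm}(z'_s)), where the central factor is written in left normal form, and N + s = Mr. -/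

import Mathlib

/-!
Axiomatization of Garside groups (positive cone, Garside element, lattice
structure, left/right normal forms), following the paper
"On the cycling operation in braid groups" by Gebhardt and González-Meneses.
-/

namespace Garside

variable {G : Type*} [Group G]

/-- `a ≼ b`: `a` is a left divisor (prefix) of `b` w.r.t. the positive cone `P`. -/
def LeftDvd (P : Submonoid G) (a b : G) : Prop := a⁻¹ * b ∈ P

/-- `a` is a right divisor (suffix) of `b` w.r.t. the positive cone `P`
(i.e. `b ≽ a` in the notation of the paper). -/
def RightDvd (P : Submonoid G) (a b : G) : Prop := b * a⁻¹ ∈ P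

/-- A simple element: a positive prefix of `Δ`. -/
def Simple (P : Submonoid G) (Δ : G) (s : G) : Prop := s ∈ P ∧ LeftDvd P s Δ

/-- An atom: a nontrivial positive element which is not the product
of two nontrivial positive elements. -/
def Atom (P : Submonoid G) (a : G) : Prop :=
  a ∈ P ∧ a ≠ 1 ∧ ∀ b c : G, b ∈ P → c ∈ P → a = b * c → b = 1 ∨ c = 1

/-- `Δ^p x₁ ⋯ x_r` (with `l = [x₁,…,x_r]`) is the left normal form of `x`:
each factor is a proper simple element and consecutive factors are
left-weighted, `x_i = (x_i x_{i+1}) ∧_L Δ`. -/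
def IsLeftNF (P : Submonoid G) (Δ : G) (gcdL : G → G → G) (p : ℤ) (l : List G) (x : G) :
    Prop :=
  x = Δ ^ p * l.prod ∧ (∀ s ∈ l, Simple P Δ s ∧ s ≠ 1 ∧ s ≠ Δ) ∧
    l.Chain' (fun s t => gcdL (s * t) Δ = s)

/-- `y₁ ⋯ y_r Δ^p` (with `l = [y₁,…,y_r]`) is the right normal form of `x`:
each factor is a proper simple element and consecutive factors are
right-weighted, `y_{i+1} = (y_i y_{i+1}) ∧_R Δ`. -/
def IsRightNF (P : Submonoid G) (Δ : G) (gcdR : G → G → G) (p : ℤ) (l : List G) (x : G) :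
    Prop :=
  x = l.prod * Δ ^ p ∧ (∀ s ∈ l, Simple P Δ s ∧ s ≠ 1 ∧ s ≠ Δ) ∧
    l.Chain' (fun s t => gcdR (s * t) Δ = t)

/-- A Garside structure on a group `G`: a positive cone which induces lattice
orders by left and right divisibility, and a Garside element `Δ` whose left and
right divisors coincide (the simple elements), generate the group, and such that
every element admits a unique left and right normal form. -/
structure GarsideGroup (G : Type*) [Group G] where
  pos : Submonoid G
  pos_antisymm : ∀ a : G, a ∈ pos → a⁻¹ ∈ pos → a = 1
  Δ : G
  Δ_pos : Δ ∈ pos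
  gcdL : G → G → G
  gcdL_dvd_left : ∀ a b : G, LeftDvd pos (gcdL a b) a
  gcdL_dvd_right : ∀ a b : G, LeftDvd pos (gcdL a b) b
  dvd_gcdL : ∀ a b c : G, LeftDvd pos c a → LeftDvd pos c b → LeftDvd pos c (gcdL a b)
  lcmL : G → G → G
  dvd_lcmL_left : ∀ a b : G, LeftDvd pos a (lcmL a b)
  dvd_lcmL_right : ∀ a b : G, LeftDvd pos b (lcmL a b)
  lcmL_dvd : ∀ a b c : G, LeftDvd pos a c → LeftDvd pos b c → LeftDvd pos (lcmL a b) c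
  gcdR : G → G → G
  gcdR_dvd_left : ∀ a b : G, RightDvd pos (gcdR a b) a
  gcdR_dvd_right : ∀ a b : G, RightDvd pos (gcdR a b) b
  dvd_gcdR : ∀ a b c : G, RightDvd pos c a → RightDvd pos c b → RightDvd pos c (gcdR a b)
  lcmR : G → G → G
  dvd_lcmR_left : ∀ a b : G, RightDvd pos a (lcmR a b)
  dvd_lcmR_right : ∀ a b : G, RightDvd pos b (lcmR a b)
  lcmR_dvd : ∀ a b c : G, RightDvd pos a c → RightDvd pos b c → RightDvd pos (lcmR a b) c
  divisors_Δ : ∀ s : G, (s ∈ pos ∧ LeftDvd pos s Δ) ↔ (s ∈ pos ∧ RightDvd pos s Δ)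
  simples_generate : Subgroup.closure {s : G | Simple pos Δ s} = ⊤
  lnf_exists : ∀ x : G, ∃ pl : ℤ × List G, IsLeftNF pos Δ gcdL pl.1 pl.2 x
  lnf_unique : ∀ (x : G) (p q : ℤ) (l m : List G),
    IsLeftNF pos Δ gcdL p l x → IsLeftNF pos Δ gcdL q m x → p = q ∧ l = m
  rnf_exists : ∀ x : G, ∃ pl : ℤ × List G, IsRightNF pos Δ gcdR pl.1 pl.2 x
  rnf_unique : ∀ (x : G) (p q : ℤ) (l m : List G),
    IsRightNF pos Δ gcdR p l x → IsRightNF pos Δ gcdR q m x → p = q ∧ l = m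
  lnf_rnf_agree : ∀ (x : G) (p q : ℤ) (l m : List G),
    IsLeftNF pos Δ gcdL p l x → IsRightNF pos Δ gcdR q m x → p = q ∧ l.length = m.length

/-- `L` is the left lcm of the set `S`. -/
def IsLcmL (P : Submonoid G) (S : Set G) (L : G) : Prop :=
  (∀ a ∈ S, LeftDvd P a L) ∧ ∀ c : G, (∀ a ∈ S, LeftDvd P a c) → LeftDvd P L c

/-- A Garside group is atom-friendly (on the left) if `Δ` is the left lcm of the
set of atoms and the starting set of the left lcm of any set `B` of atoms is `B`. -/
def AtomFriendlyL (𝒢 : GarsideGroup G) : Prop :=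
  IsLcmL 𝒢.pos {a : G | Atom 𝒢.pos a} 𝒢.Δ ∧
    ∀ B : Set G, B ⊆ {a : G | Atom 𝒢.pos a} →
      ∃ L : G, IsLcmL 𝒢.pos B L ∧ {a : G | Atom 𝒢.pos a ∧ LeftDvd 𝒢.pos a L} = B

namespace GarsideGroup

variable (𝒢 : GarsideGroup G)

/-- The left normal form of `x`, as a pair (infimum, list of factors). -/
noncomputable def lnf (x : G) : ℤ × List G := Classical.choose (𝒢.lnf_exists x)

/-- The right normal form of `x`, as a pair (exponent of `Δ`, list of factors). -/
noncomputable def rnf (x : G) : ℤ × List G := Classical.choose (𝒢.rnf_exists x)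

/-- `inf x = p`, the maximal `p` with `Δ^p ≼ x`. -/
noncomputable def inf (x : G) : ℤ := (𝒢.lnf x).1

/-- The canonical length `ℓ(x) = r`. -/
noncomputable def len (x : G) : ℕ := (𝒢.lnf x).2.length

/-- `sup x = p + r`. -/
noncomputable def sup (x : G) : ℤ := 𝒢.inf x + 𝒢.len x

/-- `tau 𝒢 k x = τ^k(x) = Δ^{-k} x Δ^k`. -/
def tau (k : ℤ) (x : G) : G := 𝒢.Δ ^ (-k) * x * 𝒢.Δ ^ k

/-- The left initial factor `ι_L(x) = τ^{-p}(x₁)` (equal to `1` if `ℓ(x) = 0`). -/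
noncomputable def iotaL (x : G) : G := 𝒢.tau (-(𝒢.lnf x).1) ((𝒢.lnf x).2.headD 1)

/-- The right initial factor `ι_R(x) = τ^{p}(y_r)` (equal to `1` if `ℓ(x) = 0`). -/
noncomputable def iotaR (x : G) : G := 𝒢.tau (𝒢.rnf x).1 (((𝒢.rnf x).2.getLast?).getD 1)

/-- Left cycling: `c_L(x) = ι_L(x)⁻¹ · x · ι_L(x)`. -/
noncomputable def cL (x : G) : G := (𝒢.iotaL x)⁻¹ * x * 𝒢.iotaL x

/-- Right cycling: `c_R(x) = ι_R(x) · x · ι_R(x)⁻¹`. -/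
noncomputable def cR (x : G) : G := 𝒢.iotaR x * x * (𝒢.iotaR x)⁻¹

/-- `x = Δ^p x₁⋯x_r` (in left normal form, `r > 0`) is left rigid if
`Δ^p x₁⋯x_r ι_L(x)` is in left normal form as written. -/
def LeftRigid (x : G) : Prop :=
  (𝒢.lnf x).2 ≠ [] ∧
    IsLeftNF 𝒢.pos 𝒢.Δ 𝒢.gcdL (𝒢.lnf x).1 ((𝒢.lnf x).2 ++ [𝒢.iotaL x]) (x * 𝒢.iotaL x)

/-- `x = y₁⋯y_r Δ^p` (in right normal form, `r > 0`) is right rigid if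
`ι_R(x) y₁⋯y_r Δ^p` is in right normal form as written. -/
def RightRigid (x : G) : Prop :=
  (𝒢.rnf x).2 ≠ [] ∧
    IsRightNF 𝒢.pos 𝒢.Δ 𝒢.gcdR (𝒢.rnf x).1 (𝒢.iotaR x :: (𝒢.rnf x).2) (𝒢.iotaR x * x)

/-- The super summit set: conjugates of minimal canonical length. -/
def SSS (x : G) : Set G :=
  {y | IsConj x y ∧ ∀ z : G, IsConj x z → 𝒢.len y ≤ 𝒢.len z}

/-- The left ultra summit set. -/
def USSL (x : G) : Set G :=
  {y ∈ 𝒢.SSS x | ∃ t : ℕ, 1 ≤ t ∧ (𝒢.cL)^[t] y = y}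

/-- The right ultra summit set. -/
def USSR (x : G) : Set G :=
  {y ∈ 𝒢.SSS x | ∃ t : ℕ, 1 ≤ t ∧ (𝒢.cR)^[t] y = y}

/-- `x` is periodically geodesic: `inf(x^m) = m inf(x)` and `sup(x^m) = m sup(x)`
for all `m ≥ 1`. -/
def PeriodicallyGeodesic (x : G) : Prop :=
  ∀ m : ℕ, 1 ≤ m → 𝒢.inf (x ^ m) = (m : ℤ) * 𝒢.inf x ∧ 𝒢.sup (x ^ m) = (m : ℤ) * 𝒢.sup x

/-- The left interior `x°_L = x Δ^{-p}`, where `p = inf(x)`. -/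
noncomputable def intL (x : G) : G := x * 𝒢.Δ ^ (-𝒢.inf x)

/-- The right interior `x°_R = Δ^{-p} x`, where `p = inf(x)`. -/
noncomputable def intR (x : G) : G := 𝒢.Δ ^ (-𝒢.inf x) * x

/-- The right transport of `v` (where `v x v⁻¹ = z`):
`v^{(1)}_R = ι_R(z) · v · ι_R(x)⁻¹`. -/
noncomputable def transR (x v : G) : G := 𝒢.iotaR (v * x * v⁻¹) * v * (𝒢.iotaR x)⁻¹

/-- The iterated right transport `v^{(i)}_R` of `v` along the right cyclings of `x`. -/
noncomputable def transRIter (x : G) : ℕ → G → G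
  | 0, v => v
  | i + 1, v => 𝒢.transR ((𝒢.cR)^[i] x) (transRIter x i v)

/-- Arrows of the left ultra summit graph `USG_L(x)`: triples `(u, s, v)` with
`u, v ∈ USS_L(x)`, `s` simple and `s⁻¹ u s = v`. -/
def ArrL (x : G) : Set (G × G × G) :=
  {a | a.1 ∈ 𝒢.USSL x ∧ a.2.2 ∈ 𝒢.USSL x ∧ Simple 𝒢.pos 𝒢.Δ a.2.1 ∧
    a.2.1⁻¹ * a.1 * a.2.1 = a.2.2}

/-- Arrows of the right ultra summit graph `USG_R(x)`: triples `(u, s, v)` with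
`u, v ∈ USS_R(x)`, `s` simple and `s u s⁻¹ = v`. -/
def ArrR (x : G) : Set (G × G × G) :=
  {a | a.1 ∈ 𝒢.USSR x ∧ a.2.2 ∈ 𝒢.USSR x ∧ Simple 𝒢.pos 𝒢.Δ a.2.1 ∧
    a.2.1 * a.1 * a.2.1⁻¹ = a.2.2}

/-- `PathFrom A u l`: the list of arrows `l` forms a directed path in the
graph with arrow set `A`, starting at the vertex `u`. -/
def PathFrom (A : Set (G × G × G)) : G → List (G × G × G) → Prop
  | _, [] => True
  | u, a :: rest => a ∈ A ∧ a.1 = u ∧ PathFrom A a.2.2 rest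

/-- Minimal arrows of `USG_L(x)`: arrows whose label is not a product of the
labels of a directed path of length at least 2 starting at the same vertex. -/
def MinArrL (x : G) : Set (G × G × G) :=
  {a | a ∈ 𝒢.ArrL x ∧ ¬ ∃ l : List (G × G × G), 2 ≤ l.length ∧
    PathFrom (𝒢.ArrL x) a.1 l ∧ (l.map (fun b => b.2.1)).prod = a.2.1}

/-- Minimal arrows of `USG_R(x)`. -/
def MinArrR (x : G) : Set (G × G × G) :=
  {a | a ∈ 𝒢.ArrR x ∧ ¬ ∃ l : List (G × G × G), 2 ≤ l.length ∧
    PathFrom (𝒢.ArrR x) a.1 l ∧ (l.map (fun b => b.2.1)).prod = a.2.1}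

end GarsideGroup

end Garside

namespace Garside

namespace GarsideGroup

variable {G : Type*} [Group G] (𝒢 : GarsideGroup G)

/-- Left-weightedness, expressed by divisibility only. -/
def LW (s t : G) : Prop :=
  ∀ a : G, a⁻¹ * (s * t) ∈ 𝒢.pos → a⁻¹ * 𝒢.Δ ∈ 𝒢.pos → a⁻¹ * s ∈ 𝒢.pos

/-- A list of proper simple elements with consecutive factors left-weighted. -/
def NL (l : List G) : Prop :=
  (∀ s ∈ l, Simple 𝒢.pos 𝒢.Δ s ∧ s ≠ 1 ∧ s ≠ 𝒢.Δ) ∧ l.IsChain 𝒢.LW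

theorem lw_iff {s t : G} (hs : s⁻¹ * 𝒢.Δ ∈ 𝒢.pos) (ht : t ∈ 𝒢.pos) :
    𝒢.gcdL (s * t) 𝒢.Δ = s ↔ 𝒢.LW s t := by
  constructor
  · intro h a h1 h2
    have := 𝒢.dvd_gcdL (s * t) 𝒢.Δ a h1 h2
    rw [h] at this
    exact this
  · intro h
    have h1 : (𝒢.gcdL (s * t) 𝒢.Δ)⁻¹ * s ∈ 𝒢.pos :=
      h _ (𝒢.gcdL_dvd_left _ _) (𝒢.gcdL_dvd_right _ _)
    have h2 : s⁻¹ * 𝒢.gcdL (s * t) 𝒢.Δ ∈ 𝒢.pos :=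
      𝒢.dvd_gcdL _ _ _ (by simpa [LeftDvd] using ht) hs
    have := 𝒢.pos_antisymm _ h2 (by simpa using h1)
    exact (inv_mul_eq_one.1 this).symm

theorem isLeftNF_iff {p : ℤ} {l : List G} {x : G} :
    IsLeftNF 𝒢.pos 𝒢.Δ 𝒢.gcdL p l x ↔ x = 𝒢.Δ ^ p * l.prod ∧ 𝒢.NL l := by
  unfold IsLeftNF NL
  refine and_congr_right fun _ => and_congr_right fun h => ?_
  change List.IsChain _ l ↔ _
  constructor
  · intro hc
    exact hc.imp_of_mem_imp fun a b ha hb hab => (𝒢.lw_iff (h a ha).1.2 (h b hb).1.1).1 hab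
  · intro hc
    exact hc.imp_of_mem_imp fun a b ha hb hab => (𝒢.lw_iff (h a ha).1.2 (h b hb).1.1).2 hab

theorem simple_conj {s : G} (h : Simple 𝒢.pos 𝒢.Δ s) :
    Simple 𝒢.pos 𝒢.Δ (𝒢.Δ⁻¹ * s * 𝒢.Δ) ∧ Simple 𝒢.pos 𝒢.Δ (𝒢.Δ * s * 𝒢.Δ⁻¹) := by
  have hr : 𝒢.Δ * s⁻¹ ∈ 𝒢.pos := ((𝒢.divisors_Δ s).1 h).2
  have hl : s⁻¹ * 𝒢.Δ ∈ 𝒢.pos := h.2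
  constructor
  · have h1 := (𝒢.divisors_Δ (s⁻¹ * 𝒢.Δ)).2 ⟨hl, by
      have := h.1; unfold RightDvd; simpa [mul_assoc] using this⟩
    refine (𝒢.divisors_Δ _).2 ⟨?_, ?_⟩
    · have := h1.2; unfold LeftDvd at this; simpa [mul_assoc] using this
    · unfold RightDvd; simpa [mul_assoc] using hl
  · have h1 := (𝒢.divisors_Δ (𝒢.Δ * s⁻¹)).1 ⟨hr, by
      have := h.1; unfold LeftDvd; simpa [mul_assoc] using this⟩
    refine ⟨?_, ?_⟩
    · have := h1.2; unfold RightDvd at this; simpa [mul_assoc] using this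
    · unfold LeftDvd; simpa [mul_assoc] using hr

/-- The head of a left-weighted list is the largest simple prefix of its product. -/
theorem head_dvd : ∀ (l : List G) (s : G), 𝒢.NL (s :: l) → ∀ a : G,
    a⁻¹ * (s :: l).prod ∈ 𝒢.pos → a⁻¹ * 𝒢.Δ ∈ 𝒢.pos → a⁻¹ * s ∈ 𝒢.pos
  | [], s, _, a, h1, _ => by simpa using h1
  | t :: l, s, hn, a, h1, h2 => by
    obtain ⟨hs, hc⟩ := hn
    rw [List.isChain_cons_cons] at hc
    have ih := head_dvd l t ⟨fun u hu => hs u (List.mem_cons_of_mem _ hu), hc.2⟩ (s⁻¹ * a)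
      (by simpa [mul_assoc] using h1)
      (by
        have h3 := mul_mem h2 (𝒢.simple_conj (hs s (by simp)).1).1.1
        simpa [mul_assoc] using h3)
    exact hc.1 a (by simpa [mul_assoc] using ih) h2

theorem list_pos {l : List G} (h : ∀ s ∈ l, Simple 𝒢.pos 𝒢.Δ s ∧ s ≠ 1 ∧ s ≠ 𝒢.Δ) :
    l.prod ∈ 𝒢.pos := 𝒢.pos.list_prod_mem fun s hs => (h s hs).1.1

theorem zpow_pos {k : ℤ} (hk : 0 ≤ k) : 𝒢.Δ ^ k ∈ 𝒢.pos := by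
  lift k to ℕ using hk
  rw [zpow_natCast]
  exact pow_mem 𝒢.Δ_pos k

theorem not_delta_dvd (hΔ : 𝒢.Δ ≠ 1) {l : List G} (hl : 𝒢.NL l) : 𝒢.Δ⁻¹ * l.prod ∉ 𝒢.pos := by
  intro h
  cases l with
  | nil =>
    exact hΔ (𝒢.pos_antisymm _ 𝒢.Δ_pos (by simpa using h))
  | cons s l =>
    have h1 := 𝒢.head_dvd l s hl _ h (by simp)
    have h2 := (hl.1 s (by simp)).1.2
    exact (hl.1 s (by simp)).2.2 (inv_mul_eq_one.1 (𝒢.pos_antisymm _ h2 (by simpa using h1)))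

/-- `Δ^k ≼ x` implies `k ≤ inf x`. -/
theorem ge_le_inf (hΔ : 𝒢.Δ ≠ 1) {l : List G} (hl : 𝒢.NL l) {q k : ℤ}
    (h : 𝒢.Δ ^ (-k) * (𝒢.Δ ^ q * l.prod) ∈ 𝒢.pos) : k ≤ q := by
  by_contra hk
  apply 𝒢.not_delta_dvd hΔ hl
  have h1 := mul_mem (𝒢.zpow_pos (k := k - q - 1) (by omega)) h
  convert h1 using 1
  rw [← mul_assoc, ← mul_assoc, ← zpow_add, ← zpow_add]
  congr 1
  rw [← zpow_neg_one]; congr 1; ring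

theorem conj_pos (hΔ : 𝒢.Δ ≠ 1) {x : G} (hx : x ∈ 𝒢.pos) :
    𝒢.Δ⁻¹ * x * 𝒢.Δ ∈ 𝒢.pos ∧ 𝒢.Δ * x * 𝒢.Δ⁻¹ ∈ 𝒢.pos := by
  obtain ⟨⟨q, l⟩, h⟩ := 𝒢.lnf_exists x
  obtain ⟨rfl, hl⟩ := 𝒢.isLeftNF_iff.1 h
  have hq : 0 ≤ q := 𝒢.ge_le_inf hΔ hl (k := 0) (by simpa using hx)
  have key : ∀ l : List G, (∀ s ∈ l, Simple 𝒢.pos 𝒢.Δ s) →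
      𝒢.Δ⁻¹ * l.prod * 𝒢.Δ ∈ 𝒢.pos ∧ 𝒢.Δ * l.prod * 𝒢.Δ⁻¹ ∈ 𝒢.pos := by
    intro l hl
    induction l with
    | nil => simp
    | cons s l ih =>
      have h1 := ih fun t ht => hl t (by simp [ht])
      have h2 := 𝒢.simple_conj (hl s (by simp))
      refine ⟨?_, ?_⟩
      · simpa [mul_assoc] using mul_mem h2.1.1 h1.1
      · simpa [mul_assoc] using mul_mem h2.2.1 h1.2
  have h3 := key l fun s hs => (hl.1 s hs).1
  constructor
  · convert mul_mem (𝒢.zpow_pos hq) h3.1 using 1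
    dsimp only; group
  · convert mul_mem (𝒢.zpow_pos hq) h3.2 using 1
    dsimp only; group

theorem tau_add (j k : ℤ) (x : G) : 𝒢.tau j (𝒢.tau k x) = 𝒢.tau (j + k) x := by
  unfold tau; group

theorem tau_zero (x : G) : 𝒢.tau 0 x = x := by simp [tau]

theorem tau_mul (k : ℤ) (x y : G) : 𝒢.tau k (x * y) = 𝒢.tau k x * 𝒢.tau k y := by
  unfold tau; group

theorem tau_inv (k : ℤ) (x : G) : 𝒢.tau k x⁻¹ = (𝒢.tau k x)⁻¹ := by
  unfold tau; group

theorem tau_one (k : ℤ) : 𝒢.tau k 1 = 1 := by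
  unfold tau; group

theorem tau_delta (k : ℤ) : 𝒢.tau k 𝒢.Δ = 𝒢.Δ := by
  unfold tau; group

theorem tau_prod (k : ℤ) (l : List G) : 𝒢.tau k l.prod = (l.map (𝒢.tau k)).prod := by
  induction l with
  | nil => simp [tau_one]
  | cons a l ih => simp [tau_mul, ih]

theorem tau_pos (hΔ : 𝒢.Δ ≠ 1) (k : ℤ) {x : G} (hx : x ∈ 𝒢.pos) : 𝒢.tau k x ∈ 𝒢.pos := by
  induction k with
  | zero => simpa [tau_zero] using hx
  | succ k ih =>
    have := (𝒢.conj_pos hΔ ih).1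
    rw [add_comm, ← tau_add]
    simpa [tau] using this
  | pred k ih =>
    have := (𝒢.conj_pos hΔ ih).2
    rw [sub_eq_neg_add, ← tau_add]
    simpa [tau] using this

theorem tau_pos_iff (hΔ : 𝒢.Δ ≠ 1) (k : ℤ) {x : G} : 𝒢.tau k x ∈ 𝒢.pos ↔ x ∈ 𝒢.pos := by
  refine ⟨fun h => ?_, 𝒢.tau_pos hΔ k⟩
  have := 𝒢.tau_pos hΔ (-k) h
  simpa [tau_add, tau_zero] using this

theorem lw_tau (hΔ : 𝒢.Δ ≠ 1) (k : ℤ) {s t : G} (h : 𝒢.LW s t) :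
    𝒢.LW (𝒢.tau k s) (𝒢.tau k t) := by
  intro a h1 h2
  rw [← 𝒢.tau_pos_iff hΔ (-k)] at h1 h2 ⊢
  simp only [tau_mul, tau_inv, tau_add, neg_add_cancel, tau_zero, tau_delta] at h1 h2 ⊢
  exact h _ h1 h2

theorem lw_mono {s t u : G} (h : 𝒢.LW s t) (hu : u⁻¹ * t ∈ 𝒢.pos) : 𝒢.LW s u := by
  intro a h1 h2
  refine h a ?_ h2
  simpa [mul_assoc] using mul_mem h1 hu

theorem simple_tau (hΔ : 𝒢.Δ ≠ 1) (k : ℤ) {s : G} (h : Simple 𝒢.pos 𝒢.Δ s) :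
    Simple 𝒢.pos 𝒢.Δ (𝒢.tau k s) := by
  refine ⟨𝒢.tau_pos hΔ k h.1, ?_⟩
  have := 𝒢.tau_pos hΔ k h.2
  rw [tau_mul, tau_inv, tau_delta] at this
  exact this

theorem tau_injective (k : ℤ) : Function.Injective (𝒢.tau k) := by
  intro a b h
  have := congrArg (𝒢.tau (-k)) h
  simpa [tau_add, tau_zero] using this

theorem NL_tau (hΔ : 𝒢.Δ ≠ 1) (k : ℤ) {l : List G} (h : 𝒢.NL l) : 𝒢.NL (l.map (𝒢.tau k)) := by
  refine ⟨?_, List.isChain_map_of_isChain (𝒢.tau k) (fun a b => 𝒢.lw_tau hΔ k) h.2⟩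
  intro s hs
  obtain ⟨t, ht, rfl⟩ := List.mem_map.1 hs
  refine ⟨𝒢.simple_tau hΔ k (h.1 t ht).1, fun h1 => (h.1 t ht).2.1 ?_,
    fun h1 => (h.1 t ht).2.2 ?_⟩
  · exact 𝒢.tau_injective k (by rw [h1, tau_one])
  · exact 𝒢.tau_injective k (by rw [h1, tau_delta])

theorem NL_append {l m : List G} : 𝒢.NL (l ++ m) ↔ 𝒢.NL l ∧ 𝒢.NL m ∧
    ∀ x ∈ l.getLast?, ∀ y ∈ m.head?, 𝒢.LW x y := by
  unfold NL
  rw [List.isChain_append, List.forall_mem_append]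
  tauto

/-- The first `n` factors give the gcd with `Δ^n`. -/
theorem take_dvd (hΔ : 𝒢.Δ ≠ 1) : ∀ (n : ℕ) (l : List G), 𝒢.NL l → ∀ a : G,
    a⁻¹ * l.prod ∈ 𝒢.pos → a⁻¹ * 𝒢.Δ ^ (n : ℤ) ∈ 𝒢.pos → a⁻¹ * (l.take n).prod ∈ 𝒢.pos
  | 0, l, _, a, _, h2 => by simpa using h2
  | n + 1, [], _, a, h1, _ => by simpa using h1
  | n + 1, s :: l, hl, a, h1, h2 => by
    have hs := (hl.1 s (by simp)).1
    have hl' : 𝒢.NL l := (𝒢.NL_append (l := [s]) (m := l)).1 hl |>.2.1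
    set b := 𝒢.lcmL a s
    have hab : a⁻¹ * b ∈ 𝒢.pos := 𝒢.dvd_lcmL_left a s
    have hsb : s⁻¹ * b ∈ 𝒢.pos := 𝒢.dvd_lcmL_right a s
    have hb1 : b⁻¹ * (s :: l).prod ∈ 𝒢.pos := 𝒢.lcmL_dvd _ _ _ h1 (by
      simpa [LeftDvd] using 𝒢.list_pos hl'.1)
    have hb2 : b⁻¹ * 𝒢.Δ ^ ((n + 1 : ℕ) : ℤ) ∈ 𝒢.pos := 𝒢.lcmL_dvd _ _ _ h2 (by
      have := mul_mem (show s⁻¹ * 𝒢.Δ ∈ 𝒢.pos from hs.2) (𝒢.zpow_pos (Int.natCast_nonneg n))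
      unfold LeftDvd
      convert this using 1
      push_cast; group)
    have h3 := 𝒢.head_dvd l s hl (b * 𝒢.Δ ^ (-(n : ℤ)))
      (by
        convert mul_mem (𝒢.zpow_pos (Int.natCast_nonneg n)) hb1 using 1
        group)
      (by
        rw [← 𝒢.tau_pos_iff hΔ n]
        convert hb2 using 1
        unfold tau; push_cast; group)
    have ih := take_dvd hΔ n l hl' (s⁻¹ * b) (by simpa [mul_assoc] using hb1) (by
      rw [← 𝒢.tau_pos_iff hΔ n] at h3
      convert h3 using 1
      unfold tau; group)
    have := mul_mem hab ih
    simpa [mul_assoc] using this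

theorem prod_dvd_pow (hΔ : 𝒢.Δ ≠ 1) {l : List G} (h : ∀ s ∈ l, Simple 𝒢.pos 𝒢.Δ s) :
    l.prod⁻¹ * 𝒢.Δ ^ (l.length : ℤ) ∈ 𝒢.pos := by
  induction l with
  | nil => simp
  | cons s l ih =>
    have h1 := ih fun t ht => h t (by simp [ht])
    have h2 := 𝒢.tau_pos hΔ l.length (h s (by simp)).2
    convert mul_mem h1 h2 using 1
    unfold tau; simp only [List.prod_cons, List.length_cons]; push_cast; group

theorem eq_nil_of_inv {l : List G} (hl : 𝒢.NL l) (h : l.prod⁻¹ ∈ 𝒢.pos) : l = [] := by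
  cases l with
  | nil => rfl
  | cons s l =>
    exfalso
    have hl' : 𝒢.NL l := (𝒢.NL_append (l := [s]) (m := l)).1 hl |>.2.1
    apply (hl.1 s (by simp)).2.1
    refine 𝒢.pos_antisymm _ (hl.1 s (by simp)).1.1 ?_
    simpa using mul_mem (𝒢.list_pos hl'.1) h

/-- `x ≼ Δ^k` implies `sup x ≤ k`. -/
theorem le_sup_le (hΔ : 𝒢.Δ ≠ 1) {l : List G} (hl : 𝒢.NL l) {q k : ℤ}
    (h : (𝒢.Δ ^ q * l.prod)⁻¹ * 𝒢.Δ ^ k ∈ 𝒢.pos) : q + l.length ≤ k := by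
  have h0 : l.prod⁻¹ * 𝒢.Δ ^ (k - q) ∈ 𝒢.pos := by
    convert h using 1; group
  by_cases hk : q ≤ k
  · obtain ⟨j, hj⟩ : ∃ j : ℕ, k - q = j := ⟨(k - q).toNat, by omega⟩
    rw [hj] at h0
    have h1 := 𝒢.take_dvd hΔ j l hl l.prod (by simp) h0
    have h2 : (l.drop j).prod⁻¹ ∈ 𝒢.pos := by
      have h4 := List.prod_take_mul_prod_drop l j
      convert h1 using 1
      rw [← h4]; group
    have h3 : 𝒢.NL (l.drop j) := by
      rw [← List.take_append_drop j l] at hl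
      exact (𝒢.NL_append.1 hl).2.1
    have := 𝒢.eq_nil_of_inv h3 h2
    rw [List.drop_eq_nil_iff] at this
    omega
  · exfalso
    have h1 : l.prod⁻¹ ∈ 𝒢.pos := by
      convert mul_mem h0 (𝒢.zpow_pos (k := q - k) (by omega)) using 1
      group
    have := 𝒢.eq_nil_of_inv hl h1
    subst this
    have := 𝒢.ge_le_inf hΔ (l := []) (q := 0) (k := q - k) ⟨by simp, by simp⟩ (by simpa using h0)
    omega

theorem ge_mul (hΔ : 𝒢.Δ ≠ 1) {j k : ℤ} {a b : G} (ha : 𝒢.Δ ^ (-j) * a ∈ 𝒢.pos)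
    (hb : 𝒢.Δ ^ (-k) * b ∈ 𝒢.pos) : 𝒢.Δ ^ (-(j + k)) * (a * b) ∈ 𝒢.pos := by
  convert mul_mem (𝒢.tau_pos hΔ k ha) hb using 1
  unfold tau; group

theorem le_mul (hΔ : 𝒢.Δ ≠ 1) {j k : ℤ} {a b : G} (ha : a⁻¹ * 𝒢.Δ ^ j ∈ 𝒢.pos)
    (hb : b⁻¹ * 𝒢.Δ ^ k ∈ 𝒢.pos) : (a * b)⁻¹ * 𝒢.Δ ^ (j + k) ∈ 𝒢.pos := by
  convert mul_mem hb (𝒢.tau_pos hΔ k ha) using 1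
  unfold tau; group

theorem le_nf (hΔ : 𝒢.Δ ≠ 1) {l : List G} (h : ∀ s ∈ l, Simple 𝒢.pos 𝒢.Δ s) (q : ℤ) :
    (𝒢.Δ ^ q * l.prod)⁻¹ * 𝒢.Δ ^ (q + l.length) ∈ 𝒢.pos := by
  convert 𝒢.prod_dvd_pow hΔ h using 1
  group

theorem lnf_spec (x : G) : x = 𝒢.Δ ^ 𝒢.inf x * (𝒢.lnf x).2.prod ∧ 𝒢.NL (𝒢.lnf x).2 :=
  𝒢.isLeftNF_iff.1 (Classical.choose_spec (𝒢.lnf_exists x))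

theorem lnf_eq {x : G} {q : ℤ} {l : List G} (h : x = 𝒢.Δ ^ q * l.prod) (hl : 𝒢.NL l) :
    𝒢.inf x = q ∧ (𝒢.lnf x).2 = l :=
  𝒢.lnf_unique x _ _ _ _ (Classical.choose_spec (𝒢.lnf_exists x)) (𝒢.isLeftNF_iff.2 ⟨h, hl⟩)

theorem cyc_spec (hΔ : 𝒢.Δ ≠ 1) {x : G} (hl : 0 < 𝒢.len x) :
    ∃ (s : G) (t : List G), (𝒢.lnf x).2 = s :: t ∧ 𝒢.iotaL x = 𝒢.tau (-𝒢.inf x) s ∧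
      Simple 𝒢.pos 𝒢.Δ (𝒢.iotaL x) ∧ (∀ u ∈ t, Simple 𝒢.pos 𝒢.Δ u) ∧
      (𝒢.iotaL x)⁻¹ * x = 𝒢.Δ ^ 𝒢.inf x * t.prod ∧ t.length + 1 = 𝒢.len x := by
  obtain ⟨h1, h2⟩ := 𝒢.lnf_spec x
  have hd : 𝒢.iotaL x = 𝒢.tau (-𝒢.inf x) ((𝒢.lnf x).2.headD 1) := rfl
  have hlen : 𝒢.len x = (𝒢.lnf x).2.length := rfl
  cases h : (𝒢.lnf x).2 with
  | nil => rw [hlen, h] at hl; simp at hl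
  | cons s t =>
    rw [h] at h1 h2 hd hlen
    simp only [List.headD_cons] at hd
    refine ⟨s, t, rfl, hd, ?_, ?_, ?_, ?_⟩
    · rw [hd]; exact 𝒢.simple_tau hΔ _ (h2.1 s (by simp)).1
    · intro u hu; exact (h2.1 u (by simp [hu])).1
    · rw [hd]
      generalize 𝒢.inf x = q at h1 ⊢
      rw [h1]
      simp only [tau, List.prod_cons]
      group
    · rw [hlen]; simp

theorem cyc_ge (hΔ : 𝒢.Δ ≠ 1) {x : G} (hl : 0 < 𝒢.len x) :
    𝒢.Δ ^ (-𝒢.inf x) * ((𝒢.iotaL x)⁻¹ * x) ∈ 𝒢.pos ∧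
    ((𝒢.iotaL x)⁻¹ * x)⁻¹ * 𝒢.Δ ^ (𝒢.inf x + 𝒢.len x - 1) ∈ 𝒢.pos := by
  obtain ⟨s, t, h1, h2, h3, h4, h5, h6⟩ := 𝒢.cyc_spec hΔ hl
  rw [h5]
  constructor
  · simpa using 𝒢.pos.list_prod_mem fun u hu => (h4 u hu).1
  · convert 𝒢.le_nf hΔ h4 (𝒢.inf x) using 3
    omega

theorem cyc_inf (hΔ : 𝒢.Δ ≠ 1) {x : G} (hl : 0 < 𝒢.len x)
    (hmin : 𝒢.len x ≤ 𝒢.len (𝒢.cL x)) :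
    𝒢.inf (𝒢.cL x) = 𝒢.inf x ∧ 𝒢.len (𝒢.cL x) = 𝒢.len x := by
  obtain ⟨s, t, h1, h2, h3, h4, h5, h6⟩ := 𝒢.cyc_spec hΔ hl
  obtain ⟨ha, hb⟩ := 𝒢.cyc_ge hΔ hl
  obtain ⟨e, hn⟩ := 𝒢.lnf_spec (𝒢.cL x)
  have e' : (𝒢.iotaL x)⁻¹ * x * 𝒢.iotaL x =
    𝒢.Δ ^ 𝒢.inf (𝒢.cL x) * (𝒢.lnf (𝒢.cL x)).2.prod := e
  have hge := 𝒢.ge_mul hΔ (k := 0) ha (by simpa using h3.1)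
  have hle := 𝒢.le_mul hΔ (k := 1) hb (by rw [zpow_one]; exact h3.2)
  rw [e'] at hge hle
  have i1 := 𝒢.ge_le_inf hΔ hn hge
  have i2 := 𝒢.le_sup_le hΔ hn hle
  have hlen : 𝒢.len (𝒢.cL x) = (𝒢.lnf (𝒢.cL x)).2.length := rfl
  rw [← hlen] at i2
  omega

theorem isConj_cL (x : G) : IsConj x (𝒢.cL x) := by
  rw [isConj_iff]
  exact ⟨(𝒢.iotaL x)⁻¹, by simp [cL]⟩

theorem iter_spec (hΔ : 𝒢.Δ ≠ 1) {x : G} (hx : x ∈ 𝒢.SSS x) (hl : 0 < 𝒢.len x) (i : ℕ) :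
    𝒢.inf (𝒢.cL^[i] x) = 𝒢.inf x ∧ 𝒢.len (𝒢.cL^[i] x) = 𝒢.len x ∧ IsConj x (𝒢.cL^[i] x) := by
  induction i with
  | zero => exact ⟨rfl, rfl, IsConj.refl x⟩
  | succ i ih =>
    obtain ⟨h1, h2, h3⟩ := ih
    rw [Function.iterate_succ_apply']
    have h4 := h3.trans (𝒢.isConj_cL (𝒢.cL^[i] x))
    have h5 := 𝒢.cyc_inf hΔ (x := 𝒢.cL^[i] x) (by omega) (by rw [h2]; exact hx.2 _ h4)
    exact ⟨h5.1.trans h1, h5.2.trans h2, h4⟩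

theorem v_spec (hΔ : 𝒢.Δ ≠ 1) {x : G} (hx : x ∈ 𝒢.SSS x) (hl : 0 < 𝒢.len x) (i : ℕ) :
    let C := ((List.range i).map fun j => 𝒢.iotaL (𝒢.cL^[j] x)).prod
    C⁻¹ * x * C = 𝒢.cL^[i] x ∧
    𝒢.Δ ^ (-(𝒢.inf x * i)) * (C⁻¹ * x ^ i) ∈ 𝒢.pos ∧
    (C⁻¹ * x ^ i)⁻¹ * 𝒢.Δ ^ ((𝒢.inf x + 𝒢.len x - 1) * i) ∈ 𝒢.pos := by
  induction i with
  | zero => simp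
  | succ i ih =>
    intro C'
    set C := ((List.range i).map fun j => 𝒢.iotaL (𝒢.cL^[j] x)).prod with hC
    obtain ⟨h1, h2, h3⟩ := ih
    have hC' : C' = C * 𝒢.iotaL (𝒢.cL^[i] x) := by
      simp [C', hC, List.range_succ]
    obtain ⟨g1, g2, g3⟩ := 𝒢.iter_spec hΔ hx hl i
    have h4 : C'⁻¹ * x * C' = 𝒢.cL^[i + 1] x := by
      rw [Function.iterate_succ_apply', cL, hC']
      conv_rhs => rw [← h1]
      rw [← h1]; group
    have h5 : C'⁻¹ * x ^ (i + 1) = ((𝒢.iotaL (𝒢.cL^[i] x))⁻¹ * 𝒢.cL^[i] x) * (C⁻¹ * x ^ i) := by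
      rw [hC']
      nth_rewrite 3 [← h1]
      rw [pow_succ']; group
    obtain ⟨k1, k2⟩ := 𝒢.cyc_ge hΔ (x := 𝒢.cL^[i] x) (by omega)
    rw [g1] at k1
    rw [g1, g2] at k2
    refine ⟨h4, ?_, ?_⟩
    · rw [h5]
      convert 𝒢.ge_mul hΔ k1 h2 using 3
      push_cast; ring
    · rw [h5]
      convert 𝒢.le_mul hΔ k2 h3 using 2
      push_cast; ring_nf

theorem rigid_pow (hΔ : 𝒢.Δ ≠ 1) {y : G} (hy : 𝒢.LeftRigid y) (hl : 0 < 𝒢.len y) (k : ℕ) :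
    ∃ R : List G, y ^ k = 𝒢.Δ ^ (𝒢.inf y * k) * R.prod ∧ 𝒢.NL (R ++ [𝒢.iotaL y]) ∧
      R.length = k * 𝒢.len y ∧ ∀ a ∈ R.head?, a = 𝒢.tau (𝒢.inf y * k) (𝒢.iotaL y) := by
  obtain ⟨s, t, h1, h2, h3, h4, h5, h6⟩ := 𝒢.cyc_spec hΔ hl
  have hr := (𝒢.isLeftNF_iff.1 hy.2).2
  have hs : s = 𝒢.tau (𝒢.inf y) (𝒢.iotaL y) := by
    rw [h2, tau_add]; simp [tau_zero]
  induction k with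
  | zero =>
    refine ⟨[], by simp, ?_, by simp, by simp⟩
    exact (𝒢.NL_append.1 hr).2.1
  | succ k ih =>
    obtain ⟨R, e, hn, hlen, hh⟩ := ih
    refine ⟨R.map (𝒢.tau (𝒢.inf y)) ++ (𝒢.lnf y).2, ?_, ?_, ?_, ?_⟩
    · rw [pow_succ, e, List.prod_append, ← tau_prod]
      conv_lhs => rw [(𝒢.lnf_spec y).1]
      have : 𝒢.inf (𝒢.Δ ^ 𝒢.inf y * (𝒢.lnf y).2.prod) = 𝒢.inf y := by
        rw [← (𝒢.lnf_spec y).1]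
      try rw [this]
      unfold tau
      push_cast
      group
    · rw [List.append_assoc, NL_append]
      obtain ⟨n1, n2, n3⟩ := 𝒢.NL_append.1 hn
      refine ⟨𝒢.NL_tau hΔ _ n1, hr, ?_⟩
      intro a ha b hb
      rw [h1] at hb
      simp only [List.cons_append, List.head?_cons, Option.mem_def, Option.some.injEq] at hb
      subst hb
      rw [List.getLast?_map] at ha
      obtain ⟨a', ha', rfl⟩ := Option.map_eq_some_iff.1 ha
      rw [hs]
      exact 𝒢.lw_tau hΔ _ (n3 a' ha' _ (by simp))
    · simp only [List.length_append, List.length_map, hlen]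
      change _ + 𝒢.len y = _
      ring
    · intro a ha
      cases R with
      | nil =>
        have hk : k = 0 := by
          simp at hlen; omega
        subst hk
        rw [h1] at ha
        simp at ha
        rw [← ha, hs]; simp
      | cons u R =>
        simp at ha
        rw [← ha, hh u (by simp), tau_add]
        congr 1; push_cast; ring

theorem last_weighted (hΔ : 𝒢.Δ ≠ 1) {x : G} (hx : x ∈ 𝒢.SSS x) (hl : 0 < 𝒢.len x)
    (N : ℕ) (y : G) (hy : y = 𝒢.cL^[N] x) (hyr : 𝒢.LeftRigid y)
    (C : G) (hC : C = ((List.range N).map fun i => 𝒢.iotaL (𝒢.cL^[i] x)).prod)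
    (zl : List G) (hzl : 𝒢.NL zl) (hzC : C = zl.prod) (hN : zl.length = N) :
    ∀ z ∈ zl.getLast?, 𝒢.LW z (𝒢.iotaL y) := by
  intro z hz a ha1 ha2
  obtain ⟨g1, g2, g3⟩ := 𝒢.iter_spec hΔ hx hl N
  rw [← hy] at g1 g2
  obtain ⟨v1, v2, v3⟩ := 𝒢.v_spec hΔ hx hl N
  rw [← hC] at v1 v2 v3
  rw [← hy] at v1
  obtain ⟨R, e, hn, hlen, -⟩ := 𝒢.rigid_pow hΔ hyr (by omega) N
  rw [g1] at e
  rw [g2] at hlen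
  have hpow : C⁻¹ * x ^ N * C = y ^ N := by
    rw [← v1]
    have := conj_pow (a := C⁻¹) (b := x) (i := N)
    rw [inv_inv] at this
    exact this.symm
  have hNr : N ≤ N * 𝒢.len x := Nat.le_mul_of_pos_right _ hl
  set j := N * 𝒢.len x - N with hj
  have hjz : (j : ℤ) = N * 𝒢.len x - N := by rw [hj]; push_cast [hNr]; ring
  have hRn := (𝒢.NL_append.1 hn).1
  have hCpos : C ∈ 𝒢.pos := by rw [hzC]; exact 𝒢.list_pos hzl.1
  have w1 := 𝒢.take_dvd hΔ j R hRn (𝒢.Δ ^ (-(𝒢.inf x * N)) * (C⁻¹ * x ^ N))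
    (by
      have hR : R.prod = 𝒢.Δ ^ (-(𝒢.inf x * N)) * (C⁻¹ * x ^ N * C) := by
        rw [hpow, e]; group
      rw [hR]
      convert hCpos using 1; group)
    (by
      convert v3 using 1
      rw [hjz, mul_inv_rev, mul_assoc, ← zpow_neg, ← zpow_add]
      congr 2; ring)
  have hu : C * (R.drop j).prod⁻¹ ∈ 𝒢.pos := by
    convert w1 using 1
    have h1 : (R.drop j).prod = (R.take j).prod⁻¹ * R.prod := by
      rw [← List.prod_take_mul_prod_drop R j]; group
    have hR : R.prod = 𝒢.Δ ^ (-(𝒢.inf x * N)) * (C⁻¹ * x ^ N * C) := by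
      rw [hpow, e]; group
    rw [h1, hR]; group
  set Y := (R.drop j).prod with hY
  obtain ⟨zl0, rfl⟩ : ∃ zl0, zl = zl0 ++ [z] := by
    have := List.mem_getLast?_eq_getLast hz
    obtain ⟨h, h'⟩ := this
    exact ⟨zl.dropLast, by rw [h', List.dropLast_append_getLast]⟩
  have hYn : 𝒢.NL (R.drop j ++ [𝒢.iotaL y]) := by
    rw [← List.take_append_drop j R, List.append_assoc] at hn
    exact (𝒢.NL_append.1 hn).2.1
  have hYl : (R.drop j).length = N := by
    rw [List.length_drop, hlen]; omega
  have hz0 : ∀ s ∈ zl0, Simple 𝒢.pos 𝒢.Δ s := fun s hs => (hzl.1 s (by simp [hs])).1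
  have hN0 : zl0.length + 1 = N := by simpa using hN
  have hb : (zl0.prod * a)⁻¹ * 𝒢.Δ ^ (N : ℤ) ∈ 𝒢.pos := by
    have := 𝒢.le_mul hΔ (k := 1) (𝒢.prod_dvd_pow hΔ hz0) (by rw [zpow_one]; exact ha2)
    rw [← hN0]; push_cast; exact this
  rw [List.prod_append, List.prod_singleton] at hzC
  have w2 := 𝒢.take_dvd hΔ N _ hYn ((C * Y⁻¹)⁻¹ * (zl0.prod * a))
    (by
      rw [List.prod_append, List.prod_singleton, ← hY]
      convert ha1 using 1
      rw [hzC]; group)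
    (by
      convert mul_mem hb (𝒢.tau_pos hΔ N hu) using 1
      unfold tau; group)
  rw [← hYl, List.take_left, ← hY] at w2
  convert w2 using 1
  rw [hzC]; group

end GarsideGroup

end Garside

namespace Garside

/-- **Lemma 4.11.** Let `G` be a Garside group and `x ∈ SSS(x)` with
`inf(x) = p` and `ℓ(x) = r > 1`. Suppose `x` is conjugate to a left rigid
element and let `N` be such that `y = c_L^N(x)` is left rigid. With
`C_i = ι_L(c_L^{i-1}(x))` and `C = C₁⋯C_N`, one has:
(1) there is an integer `M` with `(y^M)°_R ≽ C`;
(2) for any such `M`, if `z₁⋯z_N` is the left normal form of `C` and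
`z'₁⋯z'_s` is the left normal form of `(y^M)°_R C⁻¹`, then for every `m ≥ M`
the left normal form of `(x^m)°_L` is
`(z₁⋯z_N) · (y^{m-M})°_L · (τ^{-pm}(z'₁)⋯τ^{-pm}(z'_s))`, where the central
factor is written in left normal form; moreover `N + s = Mr`. -/
theorem conjugate_to_rigid_LNF {G : Type*} [Group G] (𝒢 : GarsideGroup G)
    (x : G) (hx : x ∈ 𝒢.SSS x) (p : ℤ) (hp : 𝒢.inf x = p)
    (r : ℕ) (hr : 𝒢.len x = r) (hr1 : 1 < r)
    (hconj : ∃ w, IsConj x w ∧ 𝒢.LeftRigid w)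
    (N : ℕ) (y : G) (hy : y = (𝒢.cL)^[N] x) (hyr : 𝒢.LeftRigid y)
    (C : G) (hC : C = ((List.range N).map fun i => 𝒢.iotaL ((𝒢.cL)^[i] x)).prod) :
    (∃ M : ℕ, RightDvd 𝒢.pos C (𝒢.intR (y ^ M))) ∧
    ∀ M : ℕ, RightDvd 𝒢.pos C (𝒢.intR (y ^ M)) →
      ∀ zl zl' : List G,
        IsLeftNF 𝒢.pos 𝒢.Δ 𝒢.gcdL 0 zl C → zl.length = N →
        IsLeftNF 𝒢.pos 𝒢.Δ 𝒢.gcdL 0 zl' (𝒢.intR (y ^ M) * C⁻¹) →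
        (∀ m : ℕ, M ≤ m →
          IsLeftNF 𝒢.pos 𝒢.Δ 𝒢.gcdL 0
            (zl ++ (𝒢.lnf (𝒢.intL (y ^ (m - M)))).2 ++
              zl'.map fun w => 𝒢.tau (-(p * (m : ℤ))) w)
            (𝒢.intL (x ^ m))) ∧
        N + zl'.length = M * r := by
  subst hp hr
  have hl : 0 < 𝒢.len x := by omega
  have hΔ : 𝒢.Δ ≠ 1 := by
    intro h
    obtain ⟨-, hn⟩ := 𝒢.lnf_spec x
    have hlen : 0 < (𝒢.lnf x).2.length := hl
    obtain ⟨s, hs⟩ := List.exists_mem_of_length_pos hlen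
    have h1 := (hn.1 s hs)
    have h2 : s⁻¹ * 𝒢.Δ ∈ 𝒢.pos := h1.1.2
    rw [h, mul_one] at h2
    exact h1.2.1 (𝒢.pos_antisymm _ h1.1.1 h2)
  obtain ⟨g1, g2, g3⟩ := 𝒢.iter_spec hΔ hx hl N
  obtain ⟨v1, v2, v3⟩ := 𝒢.v_spec hΔ hx hl N
  rw [← hC] at v1 v2 v3
  rw [← hy] at v1 g1 g2
  have hpow : ∀ k : ℕ, C⁻¹ * x ^ k * C = y ^ k := by
    intro k
    rw [← v1]
    have := conj_pow (a := C⁻¹) (b := x) (i := k)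
    rw [inv_inv] at this
    exact this.symm
  have hR := 𝒢.rigid_pow hΔ hyr (by omega)
  rw [g1, g2] at hR
  set ι := 𝒢.iotaL y with hι
  have hιpos : ι ∈ 𝒢.pos := by
    obtain ⟨s, t, -, -, h3, -⟩ := 𝒢.cyc_spec hΔ (x := y) (by omega)
    exact h3.1
  have hintR : ∀ k : ℕ, 𝒢.intR (y ^ k) = 𝒢.Δ ^ (-(𝒢.inf x * k)) * y ^ k := by
    intro k
    obtain ⟨R, e, hn, -, -⟩ := hR k
    unfold GarsideGroup.intR
    rw [(𝒢.lnf_eq e (𝒢.NL_append.1 hn).1).1]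
  refine ⟨⟨N, ?_⟩, ?_⟩
  · unfold RightDvd
    rw [hintR, ← hpow]
    convert v2 using 1
    group
  intro M hM zl zl' hz hzN hz'
  obtain ⟨ez, nz⟩ := 𝒢.isLeftNF_iff.1 hz
  obtain ⟨ez', nz'⟩ := 𝒢.isLeftNF_iff.1 hz'
  rw [zpow_zero, one_mul] at ez ez'
  rw [hintR] at ez'
  have hlast := 𝒢.last_weighted hΔ hx hl N y hy hyr C hC zl nz ez hzN
  rw [← hι] at hlast
  -- the first factor of the tail divides the initial factor
  have hfirst : ∀ w ∈ zl'.head?, w⁻¹ * 𝒢.tau (𝒢.inf x * M) ι ∈ 𝒢.pos := by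
    intro w hw
    obtain ⟨R, e, hn, hlen, hh⟩ := hR M
    have hwR : w⁻¹ * R.prod ∈ 𝒢.pos := by
      have hCpos : C ∈ 𝒢.pos := by rw [ez]; exact 𝒢.list_pos nz.1
      have h1 : R.prod = zl'.prod * C := by rw [← ez', e]; group
      cases zl' with
      | nil => simp at hw
      | cons u t =>
        simp only [List.head?_cons, Option.mem_def, Option.some.injEq] at hw
        subst hw
        have ht : t.prod ∈ 𝒢.pos :=
          𝒢.list_pos fun s hs => nz'.1 s (List.mem_cons_of_mem _ hs)
        rw [h1]
        simpa [mul_assoc] using mul_mem ht hCpos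
    have hwS := (nz'.1 w (List.mem_of_mem_head? hw)).1
    cases R with
    | nil => simpa using mul_mem hwR (𝒢.tau_pos hΔ (𝒢.inf x * M) hιpos)
    | cons u R =>
      rw [← hh u (by simp)]
      exact 𝒢.head_dvd R u (𝒢.NL_append.1 hn).1 w hwR hwS.2
  have main : ∀ m : ℕ, M ≤ m → ∃ mid : List G,
      𝒢.lnf (𝒢.intL (y ^ (m - M))) = (0, mid) ∧ mid.length = (m - M) * 𝒢.len x ∧
      𝒢.NL (zl ++ mid ++ zl'.map fun w => 𝒢.tau (-(𝒢.inf x * (m : ℤ))) w) ∧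
      x ^ m * 𝒢.Δ ^ (-(𝒢.inf x * (m : ℤ))) =
        (zl ++ mid ++ zl'.map fun w => 𝒢.tau (-(𝒢.inf x * (m : ℤ))) w).prod := by
    intro m hm
    obtain ⟨k, rfl⟩ := Nat.exists_eq_add_of_le hm
    rw [Nat.add_sub_cancel_left]
    obtain ⟨R, e, hn, hlen, hh⟩ := hR k
    obtain ⟨n1, n2, n3⟩ := 𝒢.NL_append.1 hn
    set mid := R.map (𝒢.tau (-(𝒢.inf x * k))) with hmid
    have nmid : 𝒢.NL mid := 𝒢.NL_tau hΔ _ n1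
    have emid : y ^ k * 𝒢.Δ ^ (-(𝒢.inf x * (k : ℤ))) = mid.prod := by
      rw [hmid, ← 𝒢.tau_prod, e]; unfold GarsideGroup.tau; group
    have eint : 𝒢.intL (y ^ k) = 𝒢.Δ ^ (0 : ℤ) * mid.prod := by
      unfold GarsideGroup.intL
      rw [(𝒢.lnf_eq e n1).1, emid, zpow_zero, one_mul]
    have hl1 := 𝒢.lnf_eq eint nmid
    -- comparison of the shifted first factor with the shifted initial factor
    have hfirst' : ∀ w ∈ (zl'.map fun w => 𝒢.tau (-(𝒢.inf x * ((M + k : ℕ) : ℤ))) w).head?,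
        w⁻¹ * 𝒢.tau (-(𝒢.inf x * k)) ι ∈ 𝒢.pos := by
      intro w hw
      rw [List.head?_map] at hw
      obtain ⟨w', hw', rfl⟩ := Option.map_eq_some_iff.1 hw
      have := 𝒢.tau_pos hΔ (-(𝒢.inf x * ((M + k : ℕ) : ℤ))) (hfirst w' hw')
      rw [𝒢.tau_mul, 𝒢.tau_inv, 𝒢.tau_add] at this
      convert this using 3
      push_cast; ring
    refine ⟨mid, Prod.ext hl1.1 hl1.2, by rw [hmid, List.length_map, hlen], ?_, ?_⟩
    · rw [List.append_assoc, 𝒢.NL_append, 𝒢.NL_append]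
      refine ⟨nz, ⟨nmid, 𝒢.NL_tau hΔ _ nz', ?_⟩, ?_⟩
      · intro a ha b hb
        rw [hmid, List.getLast?_map] at ha
        obtain ⟨a', ha', rfl⟩ := Option.map_eq_some_iff.1 ha
        exact 𝒢.lw_mono (𝒢.lw_tau hΔ _ (n3 a' ha' ι (by simp))) (hfirst' b hb)
      · intro a ha b hb
        cases R with
        | nil =>
          have hk : k = 0 := by
            simp at hlen; omega
          subst hk
          simp only [hmid, List.map_nil, List.nil_append] at hb
          refine 𝒢.lw_mono (hlast a ha) ?_
          simpa [𝒢.tau_zero] using hfirst' b hb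
        | cons u R =>
          simp only [hmid, List.map_cons, List.cons_append, List.head?_cons, Option.mem_def,
            Option.some.injEq] at hb
          rw [← hb, hh u (by simp), 𝒢.tau_add, neg_add_cancel, 𝒢.tau_zero]
          exact hlast a ha
    · rw [List.prod_append, List.prod_append, ← emid, ← ez]
      have h1 : (zl'.map fun w => 𝒢.tau (-(𝒢.inf x * ((M + k : ℕ) : ℤ))) w).prod =
          𝒢.tau (-(𝒢.inf x * ((M + k : ℕ) : ℤ))) zl'.prod := (𝒢.tau_prod _ _).symm
      have h2 : x ^ (M + k) = C * y ^ k * y ^ M * C⁻¹ := by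
        rw [← hpow, ← hpow, add_comm, pow_add]; group
      rw [h1, ← ez', h2]
      unfold GarsideGroup.tau
      push_cast
      rw [mul_add]
      generalize 𝒢.inf x * (M : ℤ) = a
      generalize 𝒢.inf x * (k : ℤ) = b
      group
  have hnf : ∀ m : ℕ, ∀ L : List G, 𝒢.NL L →
      x ^ m * 𝒢.Δ ^ (-(𝒢.inf x * (m : ℤ))) = L.prod →
      x ^ m = 𝒢.Δ ^ (𝒢.inf x * (m : ℤ)) * (L.map (𝒢.tau (𝒢.inf x * (m : ℤ)))).prod := by
    intro m L _ e
    rw [← 𝒢.tau_prod, ← e]; unfold GarsideGroup.tau; group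
  refine ⟨?_, ?_⟩
  · intro m hm
    obtain ⟨mid, h1, -, h3, h4⟩ := main m hm
    rw [h1]
    refine 𝒢.isLeftNF_iff.2 ⟨?_, h3⟩
    have h5 := (𝒢.lnf_eq (hnf m _ h3 h4) (𝒢.NL_tau hΔ _ h3)).1
    unfold GarsideGroup.intL
    rw [h5, h4, zpow_zero, one_mul]
  · obtain ⟨mid, h1, h2, h3, h4⟩ := main M le_rfl
    have hmid : mid = [] := by simpa using h2
    subst hmid
    have h5 := hnf M _ h3 h4
    -- upper bound for the supremum of `x ^ M`
    have hxle : ∀ k : ℕ, (x ^ k)⁻¹ * 𝒢.Δ ^ ((𝒢.inf x + 𝒢.len x) * (k : ℤ)) ∈ 𝒢.pos := by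
      intro k
      induction k with
      | zero => simp
      | succ k ih =>
        have hx1 : x⁻¹ * 𝒢.Δ ^ (𝒢.inf x + 𝒢.len x) ∈ 𝒢.pos := by
          obtain ⟨ex, nx⟩ := 𝒢.lnf_spec x
          have := 𝒢.le_nf hΔ (fun s hs => (nx.1 s hs).1) (𝒢.inf x)
          rw [← ex] at this
          exact this
        have := 𝒢.le_mul hΔ ih hx1
        rw [pow_succ]
        convert this using 2
        push_cast; ring_nf
    have u1 := hxle M
    rw [h5] at u1
    have u2 := 𝒢.le_sup_le hΔ (𝒢.NL_tau hΔ _ h3) u1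
    simp only [List.length_map, List.length_append, List.length_nil, hzN] at u2
    obtain ⟨R, e, hn, hlen, -⟩ := hR M
    have e2 : 𝒢.Δ ^ (𝒢.inf x * (M : ℤ)) * R.prod =
        𝒢.Δ ^ (𝒢.inf x * (M : ℤ)) * (zl' ++ zl).prod := by
      rw [← e, List.prod_append, ← ez', ← ez]; group
    have u3 := 𝒢.le_nf hΔ (l := zl' ++ zl) (by
      intro s hs
      rcases List.mem_append.1 hs with h | h
      · exact (nz'.1 s h).1
      · exact (nz.1 s h).1) (𝒢.inf x * (M : ℤ))
    rw [← e2] at u3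
    have u4 := 𝒢.le_sup_le hΔ (𝒢.NL_append.1 hn).1 u3
    rw [hlen, List.length_append, hzN] at u4
    zify
    push_cast at u2 u4
    linarith [mul_comm (𝒢.len x : ℤ) (M : ℤ), add_mul (𝒢.inf x) (𝒢.len x : ℤ) (M : ℤ)]

end Garside
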